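/- Let n ≥ 3. Let V := ℝ^{n+1} ⊗_ℝ ℝ⁴ (the real vector space underlying ℍ^{1,n}), on which a matrix A ∈ so(1,n) acts by A ⊗ id. If α : V × V × V → ℝ is an ℝ-trilinear form which is so(1,n)-invariant, i.e. α((A⊗id)x, y, z) + α(x, (A⊗id)y, z) + α(x, y, (A⊗id)z) = 0 for all A ∈ so(1,n) and all x, y, z ∈ V, then α = 0. -/

import Mathlib

open scoped TensorProduct Matrix

/-- The Minkowski form matrix `η = diag(−1,1,…,1)` of signature `(1,n)`. -/
def lorentzEta (n : ℕ) : Matrix (Fin (n + 1)) (Fin (n + 1)) ℝ :=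
  Matrix.diagonal (fun i => if i = 0 then (-1 : ℝ) else 1)

/-- The Lie algebra `so(1,n) = {A | Aᵀη + ηA = 0}`, as a set of matrices. -/
def lorentzSo (n : ℕ) : Set (Matrix (Fin (n + 1)) (Fin (n + 1)) ℝ) :=
  {A | Aᵀ * lorentzEta n + lorentzEta n * A = 0}

/-- The action of a matrix `A` on `V = ℝ^{n+1} ⊗ ℝ⁴` by `A ⊗ id`. -/
noncomputable def actV (n : ℕ) (A : Matrix (Fin (n + 1)) (Fin (n + 1)) ℝ) :
    ((Fin (n + 1) → ℝ) ⊗[ℝ] (Fin 4 → ℝ)) →ₗ[ℝ] ((Fin (n + 1) → ℝ) ⊗[ℝ] (Fin 4 → ℝ)) :=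
  LinearMap.rTensor (Fin 4 → ℝ) (Matrix.toLin' A)

/-- The infinitesimal rotation or boost in the plane spanned by `e_p` and `e_q`. -/
def lorentzGen (n : ℕ) (p q : Fin (n + 1)) : Matrix (Fin (n + 1)) (Fin (n + 1)) ℝ :=
  Matrix.single q p (if q = 0 then (-1 : ℝ) else 1) -
    Matrix.single p q (if p = 0 then (-1 : ℝ) else 1)

lemma lorentzGen_mem_lorentzSo (n : ℕ) (p q : Fin (n + 1)) :
    lorentzGen n p q ∈ lorentzSo n := by
  ext i j
  simp only [lorentzGen, lorentzEta, Matrix.add_apply, Matrix.mul_diagonal,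
    Matrix.diagonal_mul, Matrix.transpose_apply, Matrix.sub_apply, Matrix.single_apply,
    Matrix.zero_apply]
  grind

lemma lorentzGen_mulVec_single (n : ℕ) (p q r : Fin (n + 1)) :
    lorentzGen n p q *ᵥ Pi.single r 1 =
      (if p = r then (if q = 0 then (-1 : ℝ) else 1) else 0) • Pi.single q 1 -
        (if q = r then (if p = 0 then (-1 : ℝ) else 1) else 0) • Pi.single p 1 := by
  ext i
  simp only [lorentzGen, Matrix.mulVec_single_one, Matrix.col_apply, Matrix.sub_apply,
    Matrix.single_apply, Pi.sub_apply, Pi.smul_apply, Pi.single_apply, smul_eq_mul]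
  grind

lemma actV_lorentzGen_single_tmul (n : ℕ) (p q r : Fin (n + 1)) (u : Fin 4 → ℝ) :
    actV n (lorentzGen n p q) (Pi.single r 1 ⊗ₜ[ℝ] u) =
      (if p = r then (if q = 0 then (-1 : ℝ) else 1) else 0) • (Pi.single q 1 ⊗ₜ[ℝ] u) -
        (if q = r then (if p = 0 then (-1 : ℝ) else 1) else 0) • (Pi.single p 1 ⊗ₜ[ℝ] u) := by
  rw [actV, LinearMap.rTensor_tmul, Matrix.toLin'_apply, lorentzGen_mulVec_single,
    TensorProduct.sub_tmul, TensorProduct.smul_tmul', TensorProduct.smul_tmul']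

/-- A three-index tensor on `ℝ^{n+1}` with `n ≥ 3` that is annihilated by all the maps
`e_p ↦ ε_q e_q`, `e_q ↦ -ε_p e_p` (with the other basis vectors sent to `0`) vanishes. -/
lemma tensor_eq_zero_of_lorentzGen_invariant (n : ℕ) (hn : 3 ≤ n)
    (T : Fin (n + 1) → Fin (n + 1) → Fin (n + 1) → ℝ) (ε : Fin (n + 1) → ℝ)
    (hε : ∀ i, ε i ≠ 0)
    (hT : ∀ p q i j k,
      ((if p = i then ε q else 0) * T q j k - (if q = i then ε p else 0) * T p j k) +
      ((if p = j then ε q else 0) * T i q k - (if q = j then ε p else 0) * T i p k) +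
      ((if p = k then ε q else 0) * T i j q - (if q = k then ε p else 0) * T i j p) = 0)
    (i j k : Fin (n + 1)) : T i j k = 0 := by
  have fresh (i j k : Fin (n + 1)) : ∃ l, l ≠ i ∧ l ≠ j ∧ l ≠ k := by
    have hcard : ({i, j, k} : Finset (Fin (n + 1))).card < Fintype.card (Fin (n + 1)) := by
      have := Finset.card_le_three (a := i) (b := j) (c := k)
      rw [Fintype.card_fin]
      omega
    obtain ⟨l, -, hl⟩ := Finset.exists_mem_notMem_of_card_lt_card
      (s := {i, j, k}) (t := Finset.univ) (by simpa using hcard)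
    exact ⟨l, by simpa using hl⟩
  have first (i j k : Fin (n + 1)) (hij : i ≠ j) (hik : i ≠ k) : T i j k = 0 := by
    obtain ⟨l, hi, hj, hk⟩ := fresh i j k
    simpa [hi, hj, hk, hi.symm, hij, hik, hε] using hT l i l j k
  have second (i j k : Fin (n + 1)) (hij : j ≠ i) (hjk : j ≠ k) : T i j k = 0 := by
    obtain ⟨l, hi, hj, hk⟩ := fresh i j k
    simpa [hi, hj, hk, hj.symm, hij, hjk, hε] using hT l j i l k
  have third (i j k : Fin (n + 1)) (hki : k ≠ i) (hkj : k ≠ j) : T i j k = 0 := by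
    obtain ⟨l, hi, hj, hk⟩ := fresh i j k
    simpa [hi, hj, hk, hk.symm, hki, hkj, hε] using hT l k i j l
  by_cases hij : i = j
  · by_cases hjk : j = k
    · subst hij hjk
      obtain ⟨l, hl, -, -⟩ := fresh i i i
      simpa [hl, hl.symm, hε, third l l i hl.symm hl.symm, second l i l hl.symm hl.symm]
        using hT l i l i i
    · exact third i j k (by grind) (by grind)
  · by_cases hik : i = k
    · exact second i j k (by grind) (by grind)
    · exact first i j k hij hik

/-- For `n ≥ 3`, every `so(1,n)`-invariant trilinear form on
`V = ℝ^{n+1} ⊗ ℝ⁴` (the real vector space underlying `ℍ^{1,n}`), where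
`A ∈ so(1,n)` acts by `A ⊗ id`, vanishes. -/
theorem trilinear_so_invariant_vanishes (n : ℕ) (hn : 3 ≤ n)
    (α : ((Fin (n + 1) → ℝ) ⊗[ℝ] (Fin 4 → ℝ)) →ₗ[ℝ]
      ((Fin (n + 1) → ℝ) ⊗[ℝ] (Fin 4 → ℝ)) →ₗ[ℝ]
      ((Fin (n + 1) → ℝ) ⊗[ℝ] (Fin 4 → ℝ)) →ₗ[ℝ] ℝ)
    (hα : ∀ A ∈ lorentzSo n, ∀ x y z,
      α (actV n A x) y z + α x (actV n A y) z + α x y (actV n A z) = 0) :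
    α = 0 := by
  have key (u v w : Fin 4 → ℝ) (i j k : Fin (n + 1)) :
      α (Pi.single i 1 ⊗ₜ[ℝ] u) (Pi.single j 1 ⊗ₜ[ℝ] v) (Pi.single k 1 ⊗ₜ[ℝ] w) = 0 := by
    refine tensor_eq_zero_of_lorentzGen_invariant n hn
      (fun i j k => α (Pi.single i 1 ⊗ₜ[ℝ] u) (Pi.single j 1 ⊗ₜ[ℝ] v) (Pi.single k 1 ⊗ₜ[ℝ] w))
      (fun i => if i = 0 then -1 else 1) (fun i => by split_ifs <;> norm_num) ?_ i j k
    intro p q i j k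
    have h := hα _ (lorentzGen_mem_lorentzSo n p q) (Pi.single i 1 ⊗ₜ[ℝ] u)
      (Pi.single j 1 ⊗ₜ[ℝ] v) (Pi.single k 1 ⊗ₜ[ℝ] w)
    simpa only [actV_lorentzGen_single_tmul, map_sub, map_smul, LinearMap.sub_apply,
      LinearMap.smul_apply, smul_eq_mul] using h
  ext i a j b k c
  simpa using key (Pi.single a 1) (Pi.single b 1) (Pi.single c 1) i j k
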